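/- arXiv:2204.05026 — 2 statements merged into one kernel-verified Lean document; each statement's English description precedes it below -/
import Mathlib

section
/- Let n be a positive integer divisible by 4 and let Γ = IOCG_n(D,σ) be an integral oriented circulant graph with Hermitian eigenvalues μ_0,…,μ_{n−1} (indices read modulo n). Then Γ has perfect state transfer between the vertices b + n/2 and b for every b ∈ Z_n if and only if there exists a nonnegative integer m such that for every j = 0, 1, …, n−1 one has μ_{j+1} − μ_j ≠ 0 and ν₂(μ_{j+1} − μ_j) = m. -/
open Complex Finset

noncomputable section

/-- `G_n^r(d) = { dk : k ≡ r (mod 4), gcd(dk, n) = d } ⊆ {1, …, n−1}`. -/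
def Gsetr (n r d : ℕ) : Finset ℕ :=
  (Finset.range n).filter (fun a => d ∣ a ∧ (a / d) % 4 = r ∧ Nat.gcd a n = d)

/-- The symbol `C = ⋃_{d ∈ D} S_n(d)` of the integral oriented circulant graph
`IOCG_n(D, σ)`, where `S_n(d) = G_n^1(d)` if `σ d = 1` and `S_n(d) = G_n^3(d)` otherwise. -/
def symbol (n : ℕ) (D : Finset ℕ) (σ : ℕ → ℤ) : Finset ℕ :=
  D.biUnion (fun d => Gsetr n (if σ d = 1 then 1 else 3) d)

/-- The Hermitian adjacency matrix of the oriented circulant graph with symbol `C`. -/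
def hermMatrix (n : ℕ) [NeZero n] (C : Finset ℕ) : Matrix (ZMod n) (ZMod n) ℂ :=
  Matrix.of fun u v =>
    if (v - u).val ∈ C then Complex.I
    else if (u - v).val ∈ C then -Complex.I else 0

/-- The transition matrix `U(t) = exp(i t H)`. -/
def transitionMatrix (n : ℕ) [NeZero n] (C : Finset ℕ) (t : ℝ) :
    Matrix (ZMod n) (ZMod n) ℂ :=
  NormedSpace.exp ((Complex.I * (t : ℂ)) • hermMatrix n C)

/-- Perfect state transfer from `u` to `v`. -/
def hasPST (n : ℕ) [NeZero n] (C : Finset ℕ) (u v : ZMod n) : Prop :=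
  ∃ (t : ℝ) (γ : ℂ), ‖γ‖ = 1 ∧
    (transitionMatrix n C t).mulVec (Pi.single u 1) = γ • (Pi.single v 1 : ZMod n → ℂ)

/-- Multiple state transfer on a vertex set `S`: PST between every pair of
distinct vertices of `S`. -/
def hasMST (n : ℕ) [NeZero n] (C : Finset ℕ) (S : Set (ZMod n)) : Prop :=
  ∀ u ∈ S, ∀ v ∈ S, u ≠ v → hasPST n C u v

/-- The Hermitian eigenvalues `μ_j = i ∑_{k ∈ C} (ω^{jk} − ω^{−jk})`, `ω = exp(2πi/n)`. -/
def eigval (n : ℕ) (C : Finset ℕ) (j : ℕ) : ℂ :=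
  Complex.I * ∑ k ∈ C, (Complex.exp (2 * Real.pi * Complex.I * j * k / n) -
    Complex.exp (-(2 * Real.pi * Complex.I * j * k / n)))

/-- Ramanujan's sum `c_n(q) = ∑_{1 ≤ a ≤ n, gcd(a,n)=1} exp(2πi a q / n)`. -/
def ramanujanSum (n q : ℕ) : ℂ :=
  ∑ a ∈ (Finset.Icc 1 n).filter (fun a => Nat.gcd a n = 1),
    Complex.exp (2 * Real.pi * Complex.I * a * q / n)

/-- Ramanujan's sine sum `s_n(q) = i ∑_{a ∈ G_n^1(1)} (ω^{aq} − ω^{−aq})`. -/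
def sineSum (n q : ℕ) : ℂ :=
  Complex.I * ∑ a ∈ Gsetr n 1 1, (Complex.exp (2 * Real.pi * Complex.I * a * q / n) -
    Complex.exp (-(2 * Real.pi * Complex.I * a * q / n)))

theorem Gsetr_subset_range (n r d : ℕ) : Gsetr n r d ⊆ Finset.range n :=
  Finset.filter_subset _ _

theorem symbol_subset_range (n : ℕ) (D : Finset ℕ) (σ : ℕ → ℤ) :
    symbol n D σ ⊆ Finset.range n :=
  Finset.biUnion_subset.2 fun _ _ => Gsetr_subset_range _ _ _

/-- The symbol of an integral oriented circulant graph contains no pair of opposite elements. -/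
theorem neg_notMem_symbol {n : ℕ} [NeZero n] (hn4 : 4 ∣ n) {D : Finset ℕ}
    (hD : ∀ d ∈ D, d ∣ n / 4) (σ : ℕ → ℤ) {k : ZMod n} (hk : k.val ∈ symbol n D σ) :
    (-k).val ∉ symbol n D σ := by
  intro hk'
  simp only [symbol, Gsetr, Finset.mem_biUnion, Finset.mem_filter, Finset.mem_range] at hk hk'
  obtain ⟨d, hd, hkn, hdk, hr, hg⟩ := hk
  obtain ⟨e, he, -, hek, hr', hg'⟩ := hk'
  have hnpos : 0 < n := Nat.pos_of_ne_zero (NeZero.ne n)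
  have hk0 : k ≠ 0 := by
    rintro rfl
    rw [ZMod.val_zero, Nat.zero_div] at hr
    split_ifs at hr
  have hneg : (-k).val = n - k.val := by
    have : NeZero k := ⟨hk0⟩
    exact ZMod.val_neg_of_ne_zero k
  rw [hneg] at hg' hr'
  have hde : e = d := by
    rw [← hg', ← hg, Nat.gcd_comm, Nat.gcd_comm k.val, Nat.gcd_self_sub_right hkn.le]
  subst hde
  obtain ⟨c, hc⟩ := hD e hd
  obtain ⟨a, ha⟩ := hdk
  have hn : n = e * (4 * c) := by
    have := Nat.div_mul_cancel hn4
    rw [← this, hc]; ring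
  have he0 : 0 < e := Nat.pos_of_ne_zero (by rintro rfl; simp at hn; omega)
  rw [ha, Nat.mul_div_cancel_left _ he0] at hr
  have hsub : (n - k.val) / e = 4 * c - a := by
    rw [ha]; nth_rewrite 1 [hn]
    rw [← Nat.mul_sub, Nat.mul_div_cancel_left _ he0]
  have hac : a < 4 * c := by
    refine lt_of_mul_lt_mul_left (a := e) ?_ he0.le
    rwa [← hn, ← ha]
  rw [hsub] at hr'
  split_ifs at hr hr' <;> omega

open ZMod in
theorem stdAddChar_eq_exp {n : ℕ} [NeZero n] (j k : ℕ) :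
    stdAddChar ((k : ZMod n) * (j : ZMod n)) =
      Complex.exp (2 * Real.pi * Complex.I * j * k / n) := by
  have := stdAddChar_coe (N := n) ((k : ℤ) * j)
  push_cast at this
  rw [this]
  congr 1
  ring

theorem sum_val_mem {n : ℕ} [NeZero n] {C : Finset ℕ} (hC : C ⊆ Finset.range n)
    (g : ZMod n → ℂ) :
    ∑ k : ZMod n, (if k.val ∈ C then g k else 0) = ∑ k ∈ C, g k := by
  rw [← Finset.sum_filter]
  refine Finset.sum_nbij' ZMod.val (fun k => (k : ZMod n)) ?_ ?_ ?_ ?_ ?_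
  · intro k hk
    simpa using hk
  · intro k hk
    simpa [ZMod.val_cast_of_lt (Finset.mem_range.1 (hC hk))] using hk
  · intro k _
    simp
  · intro k hk
    exact ZMod.val_cast_of_lt (Finset.mem_range.1 (hC hk))
  · intro k _
    simp

open ZMod in
/-- The eigenvalue `μ_j` is the Fourier coefficient of the first row of the Hermitian adjacency
matrix. -/
theorem sum_stdAddChar_eq_eigval {n : ℕ} [NeZero n] {C : Finset ℕ} (hC : C ⊆ Finset.range n)
    (hneg : ∀ k : ZMod n, k.val ∈ C → (-k).val ∉ C) (j : ZMod n) :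
    ∑ k : ZMod n, (if k.val ∈ C then Complex.I else if (-k).val ∈ C then -Complex.I else 0) *
      stdAddChar (k * j) = eigval n C j.val := by
  have hsplit : ∀ k : ZMod n,
      (if k.val ∈ C then Complex.I else if (-k).val ∈ C then -Complex.I else 0) *
        stdAddChar (k * j) =
      (if k.val ∈ C then Complex.I * stdAddChar (k * j) else 0) -
        (if (-k).val ∈ C then Complex.I * stdAddChar (k * j) else 0) := by
    intro k
    by_cases h : k.val ∈ C
    · simp [h, hneg k h]
    · by_cases h' : (-k).val ∈ C <;> simp [h, h']
  have hrefl : ∑ k : ZMod n, (if (-k).val ∈ C then Complex.I * stdAddChar (k * j) else 0) =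
      ∑ k : ZMod n, (if k.val ∈ C then Complex.I * stdAddChar (-(k * j)) else 0) := by
    rw [← Equiv.sum_comp (Equiv.neg (ZMod n))]
    simp
  rw [Finset.sum_congr rfl fun k _ => hsplit k, Finset.sum_sub_distrib, hrefl,
    sum_val_mem hC, sum_val_mem hC, ← Finset.sum_sub_distrib, eigval, Finset.mul_sum]
  refine Finset.sum_congr rfl fun k _ => ?_
  have h := stdAddChar_eq_exp (n := n) j.val k
  rw [ZMod.natCast_zmod_val] at h
  rw [AddChar.map_neg_eq_inv, h, ← Complex.exp_neg, mul_sub]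

/-- The matrix of the discrete Fourier transform on `ZMod n`. -/
def fourierMatrix (n : ℕ) [NeZero n] : Matrix (ZMod n) (ZMod n) ℂ :=
  Matrix.of fun k u => ZMod.stdAddChar (-(u * k))

theorem fourierMatrix_mulVec {n : ℕ} [NeZero n] (x : ZMod n → ℂ) :
    (fourierMatrix n).mulVec x = ZMod.dft x := by
  ext k
  simp [fourierMatrix, Matrix.mulVec, dotProduct, ZMod.dft_apply]

theorem fourierMatrix_mulVec_injective (n : ℕ) [NeZero n] :
    Function.Injective (fourierMatrix n).mulVec := by
  intro x y h
  rw [fourierMatrix_mulVec, fourierMatrix_mulVec] at h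
  exact ZMod.dft.injective h

theorem isUnit_fourierMatrix (n : ℕ) [NeZero n] : IsUnit (fourierMatrix n) :=
  Matrix.mulVec_injective_iff_isUnit.1 (fourierMatrix_mulVec_injective n)

theorem fourierMatrix_mul_hermMatrix {n : ℕ} [NeZero n] {C : Finset ℕ}
    (hC : C ⊆ Finset.range n) (hneg : ∀ k : ZMod n, k.val ∈ C → (-k).val ∉ C) :
    fourierMatrix n * hermMatrix n C =
      Matrix.diagonal (fun k : ZMod n => eigval n C k.val) * fourierMatrix n := by
  ext k v
  rw [Matrix.diagonal_mul, Matrix.mul_apply, ← sum_stdAddChar_eq_eigval hC hneg k,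
    Finset.sum_mul, ← Equiv.sum_comp (Equiv.subLeft v)]
  refine Finset.sum_congr rfl fun u _ => ?_
  have : -((v - u) * k) = u * k + -(v * k) := by ring
  simp only [fourierMatrix, hermMatrix, Matrix.of_apply, Equiv.subLeft_apply, sub_sub_cancel,
    sub_sub_cancel_left, this, AddChar.map_add_eq_mul]
  ring

theorem fourierMatrix_mul_transitionMatrix {n : ℕ} [NeZero n] {C : Finset ℕ}
    (hC : C ⊆ Finset.range n) (hneg : ∀ k : ZMod n, k.val ∈ C → (-k).val ∉ C) (t : ℝ) :
    fourierMatrix n * transitionMatrix n C t =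
      Matrix.diagonal (fun k : ZMod n => Complex.exp (Complex.I * t * eigval n C k.val)) *
        fourierMatrix n := by
  have hF := isUnit_fourierMatrix n
  have hdet := (Matrix.isUnit_iff_isUnit_det _).1 hF
  have hH : (Complex.I * (t : ℂ)) • hermMatrix n C =
      (fourierMatrix n)⁻¹ *
        Matrix.diagonal (fun k : ZMod n => Complex.I * t * eigval n C k.val) *
          fourierMatrix n := by
    have hdiag : Matrix.diagonal (fun k : ZMod n => Complex.I * t * eigval n C k.val) =
        (Complex.I * (t : ℂ)) • Matrix.diagonal (fun k : ZMod n => eigval n C k.val) := by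
      rw [← Matrix.diagonal_smul]; rfl
    rw [hdiag, Matrix.mul_smul, Matrix.smul_mul, mul_assoc,
      ← fourierMatrix_mul_hermMatrix hC hneg, Matrix.nonsing_inv_mul_cancel_left _ _ hdet]
  rw [transitionMatrix, hH, Matrix.exp_conj' _ _ hF, Matrix.exp_diagonal, mul_assoc,
    Matrix.mul_nonsing_inv_cancel_left _ _ hdet]
  congr 2
  ext k
  rw [Pi.coe_exp, Complex.exp_eq_exp_ℂ]

theorem hasPST_iff {n : ℕ} [NeZero n] {C : Finset ℕ}
    (hC : C ⊆ Finset.range n) (hneg : ∀ k : ZMod n, k.val ∈ C → (-k).val ∉ C) (u v : ZMod n) :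
    hasPST n C u v ↔ ∃ (t : ℝ) (γ : ℂ), ‖γ‖ = 1 ∧ ∀ k : ZMod n,
      Complex.exp (Complex.I * t * eigval n C k.val) =
        γ * ZMod.stdAddChar ((u - v) * k) := by
  refine exists_congr fun t => exists_congr fun γ => and_congr_right fun _ => ?_
  rw [← (fourierMatrix_mulVec_injective n).eq_iff, Matrix.mulVec_mulVec,
    fourierMatrix_mul_transitionMatrix hC hneg, funext_iff]
  refine forall_congr' fun k => ?_
  have hχ : (ZMod.stdAddChar (u * k) : ℂ) ≠ 0 := by
    rw [← norm_ne_zero_iff]; simp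
  rw [Matrix.mulVec_smul, Pi.smul_apply, Matrix.mulVec_single_one, Matrix.mulVec_single_one]
  simp only [Matrix.col_apply, Matrix.diagonal_mul, fourierMatrix, Matrix.of_apply, smul_eq_mul,
    sub_mul, sub_eq_add_neg (u * k)]
  rw [AddChar.map_add_eq_mul, AddChar.map_neg_eq_inv (a := u * k), mul_inv_eq_iff_eq_mul₀ hχ,
    mul_assoc γ, mul_comm (ZMod.stdAddChar (u * k))]

theorem stdAddChar_half_mul {n : ℕ} [NeZero n] (hn : 2 ∣ n) (k : ZMod n) :
    ZMod.stdAddChar (((n / 2 : ℕ) : ZMod n) * k) = (-1 : ℂ) ^ k.val := by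
  have h := stdAddChar_eq_exp (n := n) k.val (n / 2)
  rw [ZMod.natCast_zmod_val] at h
  rw [h, ← Complex.exp_pi_mul_I, ← Complex.exp_nat_mul]
  congr 1
  have : (n : ℂ) ≠ 0 := Nat.cast_ne_zero.2 (NeZero.ne n)
  rw [Nat.cast_div hn (by norm_num)]
  push_cast
  field_simp

/-- An alternating phase condition along a cyclic sequence of even length is a condition on
consecutive differences. -/
theorem exists_phase_iff {n : ℕ} (hn0 : n ≠ 0) (hn : 2 ∣ n) (μ : ℕ → ℤ) (t : ℝ) :
    (∃ γ : ℂ, ‖γ‖ = 1 ∧ ∀ j < n, Complex.exp (Complex.I * t * μ j) = γ * (-1) ^ j) ↔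
      ∀ j < n, Complex.exp (Complex.I * t * (μ ((j + 1) % n) - μ j : ℤ)) = -1 := by
  constructor
  · rintro ⟨γ, hγ, h⟩ j hj
    have hγ0 : γ ≠ 0 := by rintro rfl; simp at hγ
    have hpow : (-1 : ℂ) ^ ((j + 1) % n) = (-1) ^ (j + 1) := by
      conv_rhs => rw [← Nat.mod_add_div (j + 1) n, pow_add, pow_mul,
        (even_iff_two_dvd.2 hn).neg_one_pow, one_pow, mul_one]
    push_cast
    rw [mul_sub, Complex.exp_sub, h _ hj, h _ (Nat.mod_lt _ (Nat.pos_of_ne_zero hn0)), hpow,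
      pow_succ]
    have : ((-1 : ℂ)) ^ j ≠ 0 := pow_ne_zero _ (by norm_num)
    field_simp
  · intro h
    refine ⟨Complex.exp (Complex.I * t * μ 0), ?_, ?_⟩
    · rw [show Complex.I * t * μ 0 = ((t * μ 0 : ℝ) : ℂ) * Complex.I by push_cast; ring]
      exact Complex.norm_exp_ofReal_mul_I _
    · intro j
      induction j with
      | zero => simp
      | succ j ih =>
        intro hj
        have h1 := h j (by omega)
        rw [Nat.mod_eq_of_lt hj] at h1
        push_cast at h1
        rw [mul_sub, Complex.exp_sub, ih (by omega)] at h1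
        rw [div_eq_iff (by simp)] at h1
        rw [h1]; ring

theorem exp_I_mul_eq_neg_one_iff (t : ℝ) (x : ℤ) :
    Complex.exp (Complex.I * t * x) = -1 ↔ ∃ q : ℤ, t * x = Real.pi * (2 * q + 1) := by
  rw [← Complex.exp_pi_mul_I, Complex.exp_eq_exp_iff_exists_int]
  refine exists_congr fun q => ?_
  have hl : Complex.I * t * x = ((t * x : ℝ) : ℂ) * Complex.I := by push_cast; ring
  have hr : Real.pi * Complex.I + q * (2 * Real.pi * Complex.I) =
      ((Real.pi * (2 * q + 1) : ℝ) : ℂ) * Complex.I := by push_cast; ring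
  rw [hl, hr, mul_left_inj' Complex.I_ne_zero, Complex.ofReal_inj]

theorem padicValInt_two_of_odd {q : ℤ} (hq : Odd q) : padicValInt 2 q = 0 := by
  refine padicValInt.eq_zero_of_not_dvd ?_
  rw [Int.odd_iff] at hq
  omega

/-- Real multiples of finitely many integers can be made odd multiples of `π` simultaneously
exactly when the integers are nonzero with a common 2-adic valuation. -/
theorem exists_odd_mul_pi_iff {ι : Type*} [Nonempty ι] (x : ι → ℤ) :
    (∃ t : ℝ, ∀ j, ∃ q : ℤ, t * x j = Real.pi * (2 * q + 1)) ↔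
      ∃ m : ℕ, ∀ j, x j ≠ 0 ∧ padicValInt 2 (x j) = m := by
  constructor
  · rintro ⟨t, ht⟩
    choose q hq using ht
    have hne : ∀ q : ℤ, (2 * q + 1 : ℝ) ≠ 0 := fun q => by
      have : (2 * q + 1 : ℤ) ≠ 0 := by omega
      exact_mod_cast this
    have hx : ∀ j, x j ≠ 0 := by
      intro j h0
      have := hq j
      rw [h0, Int.cast_zero, mul_zero] at this
      exact mul_ne_zero Real.pi_ne_zero (hne (q j)) this.symm
    obtain ⟨i⟩ := ‹Nonempty ι›
    refine ⟨padicValInt 2 (x i), fun j => ⟨hx j, ?_⟩⟩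
    have hcross : x j * (2 * q i + 1) = x i * (2 * q j + 1) := by
      have : Real.pi * ((x j : ℝ) * (2 * q i + 1)) = Real.pi * (x i * (2 * q j + 1)) := by
        linear_combination (-(x j : ℝ)) * hq i + (x i : ℝ) * hq j
      exact_mod_cast mul_left_cancel₀ Real.pi_ne_zero this
    have := congrArg (padicValInt 2) hcross
    rwa [padicValInt.mul (hx j) (by omega), padicValInt.mul (hx i) (by omega),
      padicValInt_two_of_odd ⟨q i, rfl⟩, padicValInt_two_of_odd ⟨q j, rfl⟩] at this
  · rintro ⟨m, hm⟩
    refine ⟨Real.pi / 2 ^ m, fun j => ?_⟩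
    obtain ⟨hx, hv⟩ := hm j
    obtain ⟨y, hy⟩ : (2 : ℤ) ^ m ∣ x j := by
      have := (padicValInt_dvd_iff (p := 2) m (x j)).2 (Or.inr hv.ge)
      exact_mod_cast this
    have hodd : Odd y := by
      rw [← Int.not_even_iff_odd, even_iff_two_dvd]
      rintro ⟨z, rfl⟩
      have h2 : ((2 : ℕ) : ℤ) ^ (m + 1) ∣ x j := ⟨z, by rw [hy]; push_cast; ring⟩
      rcases (padicValInt_dvd_iff (p := 2) (m + 1) (x j)).1 h2 with h | h
      · exact hx h
      · omega
    obtain ⟨q, rfl⟩ := hodd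
    refine ⟨q, ?_⟩
    rw [hy]
    push_cast
    field_simp

theorem pst_antipodal_iff_val_const (n : ℕ) [NeZero n] (hn4 : 4 ∣ n)
    (D : Finset ℕ) (hD : ∀ d ∈ D, d ∣ n / 4)
    (σ : ℕ → ℤ) (hσ : ∀ d ∈ D, σ d = 1 ∨ σ d = -1)
    (μ : ℕ → ℤ) (hμ : ∀ j < n, (μ j : ℂ) = eigval n (symbol n D σ) j) :
    (∀ b : ZMod n, hasPST n (symbol n D σ) (b + (n / 2 : ℕ)) b) ↔
      ∃ m : ℕ, ∀ j < n, μ ((j + 1) % n) - μ j ≠ 0 ∧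
        padicValInt 2 (μ ((j + 1) % n) - μ j) = m := by
  have hn2 : 2 ∣ n := dvd_trans (by norm_num) hn4
  have hn0 : n ≠ 0 := NeZero.ne n
  have : Nonempty {j // j < n} := ⟨⟨0, Nat.pos_of_ne_zero hn0⟩⟩
  have hpst : ∀ b : ZMod n, hasPST n (symbol n D σ) (b + (n / 2 : ℕ)) b ↔
      ∃ t : ℝ, ∀ j < n, Complex.exp (Complex.I * t * (μ ((j + 1) % n) - μ j : ℤ)) = -1 := by
    intro b
    rw [hasPST_iff (symbol_subset_range n D σ) fun k => neg_notMem_symbol hn4 hD σ]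
    refine exists_congr fun t => ?_
    rw [← exists_phase_iff hn0 hn2]
    refine exists_congr fun γ => and_congr_right fun _ => ?_
    simp only [add_sub_cancel_left, stdAddChar_half_mul hn2]
    constructor
    · intro h j hj
      have := h j
      rwa [ZMod.val_cast_of_lt hj, ← hμ j hj] at this
    · intro h k
      rw [← hμ _ k.val_lt]
      exact h _ k.val_lt
  have hodd := exists_odd_mul_pi_iff fun j : {j // j < n} => μ ((j + 1) % n) - μ j
  simp only [Subtype.forall] at hodd
  simp only [hpst, forall_const, exp_I_mul_eq_neg_one_iff]
  exact hodd

end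
end

section
/- Let n be a positive integer divisible by 4 and let Γ = IOCG_n(D,σ) be an integral oriented circulant graph with Hermitian eigenvalues μ_0,…,μ_{n−1}, and assume D₂ = {d ∈ D : ν₂(n/d) = 2} is nonempty. Then μ_j is even for every odd j with 1 ≤ j ≤ n−1, and the integers μ_j/2, as j ranges over the odd integers with 1 ≤ j ≤ n−1, all have the same parity if and only if D₂ = {n/4}. -/
open Complex Finset

noncomputable section

/-- Residues modulo `N` that are coprime to `N` and congruent to `r` modulo `4`. -/
def unitsMod4 (N r : ℕ) : Finset ℕ :=
  (Finset.range N).filter (fun b => b % 4 = r ∧ b.Coprime N)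

lemma mem_Gsetr_iff {d N r k : ℕ} (hd : 0 < d) :
    k ∈ Gsetr (d * N) r d ↔ ∃ b ∈ unitsMod4 N r, d * b = k := by
  simp only [Gsetr, unitsMod4, Finset.mem_filter, Finset.mem_range]
  constructor
  · rintro ⟨hk, ⟨b, rfl⟩, hr, hg⟩
    rw [Nat.mul_div_cancel_left _ hd] at hr
    rw [Nat.gcd_mul_left] at hg
    exact ⟨b, ⟨lt_of_mul_lt_mul_left hk hd.le, hr, by
      rw [Nat.Coprime]; exact Nat.eq_of_mul_eq_mul_left hd (by omega)⟩, rfl⟩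
  · rintro ⟨b, ⟨hb, hr, hc⟩, rfl⟩
    refine ⟨Nat.mul_lt_mul_of_pos_left hb hd, dvd_mul_right _ _, ?_, ?_⟩
    · rwa [Nat.mul_div_cancel_left _ hd]
    · rw [Nat.gcd_mul_left, hc, mul_one]

lemma sum_Gsetr {d N r : ℕ} (hd : 0 < d) (f : ℕ → ℂ) :
    ∑ k ∈ Gsetr (d * N) r d, f k = ∑ b ∈ unitsMod4 N r, f (d * b) := by
  have : Gsetr (d * N) r d = (unitsMod4 N r).image (fun b => d * b) := by
    ext k
    rw [mem_Gsetr_iff hd, Finset.mem_image]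
  rw [this, Finset.sum_image]
  intro a _ b _ h
  exact Nat.eq_of_mul_eq_mul_left hd h

lemma mem_unitsMod4_four_mul {M r b : ℕ} (hr : r = 1 ∨ r = 3) :
    b ∈ unitsMod4 (4 * M) r ↔ b < 4 * M ∧ b % 4 = r ∧ b.Coprime M := by
  simp only [unitsMod4, Finset.mem_filter, Finset.mem_range]
  refine and_congr_right fun _ => and_congr_right fun hb => ?_
  rw [Nat.coprime_mul_iff_right, and_iff_right_iff_imp]
  intro _
  have h2 : b.Coprime 2 := (Nat.coprime_two_right).2 (Nat.odd_iff.2 (by omega))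
  exact Nat.Coprime.pow_right 2 h2

lemma coprime_of_dvd_add_of_coprime {a b M : ℕ} (h : M ∣ a + b) (ha : a.Coprime M) :
    b.Coprime M := by
  refine Nat.dvd_one.1 (ha ▸ Nat.dvd_gcd ?_ (Nat.gcd_dvd_right b M))
  exact (Nat.dvd_add_left (Nat.gcd_dvd_left b M)).1 ((Nat.gcd_dvd_right b M).trans h)

lemma sum_pow_unitsMod4_eq_zero {M r : ℕ} (hM : Even M) (hr : r = 1 ∨ r = 3) {z : ℂ}
    (hz : z ^ (2 * M) = -1) : ∑ b ∈ unitsMod4 (4 * M) r, z ^ b = 0 := by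
  obtain ⟨K, hK⟩ := hM
  refine Finset.sum_involution
    (fun b _ => if b < 2 * M then b + 2 * M else b - 2 * M) ?_ ?_ ?_ ?_
  · intro b hb
    split_ifs with h
    · rw [pow_add, hz]; ring
    · obtain ⟨c, rfl⟩ := Nat.exists_eq_add_of_le (not_lt.1 h)
      rw [Nat.add_sub_cancel_left, pow_add, hz]; ring
  · intro b hb _
    rw [mem_unitsMod4_four_mul hr] at hb
    split_ifs <;> omega
  · intro b hb
    rw [mem_unitsMod4_four_mul hr] at hb ⊢
    obtain ⟨h1, h2, h3⟩ := hb
    split_ifs with h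
    · exact ⟨by omega, by omega, by simpa using h3⟩
    · obtain ⟨c, rfl⟩ := Nat.exists_eq_add_of_le (not_lt.1 h)
      rw [Nat.add_sub_cancel_left]
      exact ⟨by omega, by omega, by simpa using h3⟩
  · intro b hb
    rw [mem_unitsMod4_four_mul hr] at hb
    split_ifs <;> omega

lemma sum_inv_pow_unitsMod4 {M r : ℕ} (hM : Odd M) (hr : r = 1 ∨ r = 3) {z : ℂ}
    (hz : z ^ (2 * M) = -1) :
    ∑ b ∈ unitsMod4 (4 * M) r, (z ^ b)⁻¹ = -∑ b ∈ unitsMod4 (4 * M) r, z ^ b := by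
  obtain ⟨K, hK⟩ := hM
  have hadd : ∀ {b : ℕ}, b < 4 * M → ∃ c, (c = 2 * M ∨ c = 6 * M) ∧
      b + (if b < 2 * M then 2 * M - b else 6 * M - b) = c := by
    intro b hb
    split_ifs
    · exact ⟨2 * M, .inl rfl, by omega⟩
    · exact ⟨6 * M, .inr rfl, by omega⟩
  have hmem : ∀ b ∈ unitsMod4 (4 * M) r,
      (if b < 2 * M then 2 * M - b else 6 * M - b) ∈ unitsMod4 (4 * M) r := by
    intro b hb
    rw [mem_unitsMod4_four_mul hr] at hb ⊢
    obtain ⟨h1, h2, h3⟩ := hb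
    refine ⟨?_, ?_, ?_⟩
    · split_ifs <;> omega
    · split_ifs <;> omega
    · refine coprime_of_dvd_add_of_coprime ?_ h3
      obtain ⟨c, hc | hc, h⟩ := hadd h1 <;> rw [h, hc] <;> exact dvd_mul_left _ _
  rw [← Finset.sum_neg_distrib]
  refine Finset.sum_nbij' (fun b => if b < 2 * M then 2 * M - b else 6 * M - b)
    (fun b => if b < 2 * M then 2 * M - b else 6 * M - b) hmem hmem ?_ ?_ ?_
  · intro b hb
    rw [mem_unitsMod4_four_mul hr] at hb
    split_ifs <;> omega
  · intro b hb
    rw [mem_unitsMod4_four_mul hr] at hb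
    split_ifs <;> omega
  · intro b hb
    rw [mem_unitsMod4_four_mul hr] at hb
    refine inv_eq_of_mul_eq_one_right ?_
    rw [mul_neg, ← pow_add]
    obtain ⟨c, hc | hc, h⟩ := hadd hb.1 <;> rw [h, hc]
    · rw [hz, neg_neg]
    · rw [show 6 * M = 2 * M * 3 by ring, pow_mul, hz]; norm_num

lemma two_dvd_of_eq_two_mul_isIntegral {a : ℤ} {z : ℂ} (hz : IsIntegral ℤ z)
    (h : (a : ℂ) = 2 * z) : (2 : ℤ) ∣ a := by
  have h1 : z = algebraMap ℚ ℂ ((a : ℚ) / 2) := by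
    simp [h]
  rw [h1, isIntegral_algebraMap_iff (algebraMap ℚ ℂ).injective,
    IsIntegrallyClosed.isIntegral_iff] at hz
  obtain ⟨y, hy⟩ := hz
  refine ⟨y, ?_⟩
  have : (a : ℚ) = 2 * y := by
    simp only [eq_intCast] at hy
    rw [hy]; ring
  exact_mod_cast this

lemma isIntegral_I : IsIntegral ℤ Complex.I :=
  IsIntegral.of_pow (n := 2) (by norm_num) (by rw [Complex.I_sq]; exact isIntegral_one.neg)

lemma geom_sum_eq_zero_of_pow_eq_one {x : ℂ} {m : ℕ} (hx : x ≠ 1) (hm : x ^ m = 1) :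
    ∑ l ∈ Finset.range m, x ^ l = 0 := by
  rw [geom_sum_eq hx, hm, sub_self, zero_div]

lemma exists_eq_four_mul_odd {N : ℕ} (h : padicValNat 2 N = 2) : ∃ M, Odd M ∧ N = 4 * M := by
  have hN : N ≠ 0 := by rintro rfl; simp at h
  obtain ⟨k, m, hm, rfl⟩ := Nat.exists_eq_two_pow_mul_odd hN
  have h2 : ¬ 2 ∣ m := by rw [← even_iff_two_dvd]; exact Nat.not_even_iff_odd.2 hm
  rw [padicValNat_base_pow_mul (by norm_num) hm.pos.ne', padicValNat.eq_zero_of_not_dvd h2] at h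
  exact ⟨m, hm, by rw [show k = 2 by omega]; norm_num⟩

lemma padicValNat_two_four_mul_odd {M : ℕ} (h : Odd M) : padicValNat 2 (4 * M) = 2 := by
  have h2 : ¬ 2 ∣ M := by rw [← even_iff_two_dvd]; exact Nat.not_even_iff_odd.2 h
  rw [show 4 * M = 2 ^ 2 * M by ring, padicValNat_base_pow_mul (by norm_num) h.pos.ne',
    padicValNat.eq_zero_of_not_dvd h2]

lemma sum_symbol (n : ℕ) (D : Finset ℕ) (σ : ℕ → ℤ) (f : ℕ → ℂ) :
    ∑ k ∈ symbol n D σ, f k =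
      ∑ d ∈ D, ∑ k ∈ Gsetr n (if σ d = 1 then 1 else 3) d, f k := by
  rw [symbol, Finset.sum_biUnion]
  intro d _ e _ hde
  refine Finset.disjoint_left.2 fun k hk hk' => hde ?_
  simp only [Gsetr, Finset.mem_filter] at hk hk'
  rw [← hk.2.2.2, ← hk'.2.2.2]

/-- At odd indices only the divisors with `ν₂(n/d) = 2` contribute to the eigenvalue. -/
lemma eigval_symbol_of_odd {n : ℕ} (hn : 0 < n) (hn4 : 4 ∣ n) {D : Finset ℕ}
    (hD : ∀ d ∈ D, d ∣ n / 4) (σ : ℕ → ℤ) {ω : ℂ}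
    (hω : ω = Complex.exp (2 * Real.pi * Complex.I / n)) (hω2 : ω ^ (n / 2) = -1)
    {j : ℕ} (hj : Odd j) :
    eigval n (symbol n D σ) j = 2 * (Complex.I *
      ∑ k ∈ symbol n (D.filter (fun d => padicValNat 2 (n / d) = 2)) σ, ω ^ (j * k)) := by
  have hexp : ∀ k : ℕ, Complex.exp (2 * Real.pi * Complex.I * j * k / n) = ω ^ (j * k) := by
    intro k
    rw [hω, ← Complex.exp_nat_mul]
    congr 1
    push_cast
    ring
  simp only [eigval, Complex.exp_neg, hexp]
  rw [sum_symbol, sum_symbol, Finset.sum_filter, mul_left_comm]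
  congr 1
  rw [Finset.mul_sum]
  refine Finset.sum_congr rfl fun d hd => ?_
  obtain ⟨M, hM⟩ := hD d hd
  have hnM : n = d * (4 * M) := by
    rw [mul_left_comm, ← hM, Nat.mul_div_cancel' hn4]
  have hd0 : 0 < d := Nat.pos_of_ne_zero fun h => by simp [h] at hnM; omega
  have hr : (if σ d = 1 then 1 else 3) = 1 ∨ (if σ d = 1 then 1 else 3) = 3 := by
    split_ifs <;> simp
  generalize (if σ d = 1 then 1 else 3) = r at hr
  have hz : (ω ^ (j * d)) ^ (2 * M) = -1 := by
    rw [← pow_mul, show j * d * (2 * M) = n / 2 * j by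
      rw [hnM, show d * (4 * M) = 2 * (d * (2 * M)) by ring,
        Nat.mul_div_cancel_left _ (by norm_num)]; ring, pow_mul, hω2, hj.neg_one_pow]
  have hS : ∑ k ∈ Gsetr n r d, ω ^ (j * k) =
      ∑ b ∈ unitsMod4 (4 * M) r, (ω ^ (j * d)) ^ b := by
    rw [hnM, sum_Gsetr hd0]
    refine Finset.sum_congr rfl fun b _ => ?_
    rw [← mul_assoc, pow_mul]
  have hS' : ∑ k ∈ Gsetr n r d, (ω ^ (j * k))⁻¹ =
      ∑ b ∈ unitsMod4 (4 * M) r, ((ω ^ (j * d)) ^ b)⁻¹ := by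
    rw [hnM, sum_Gsetr hd0]
    refine Finset.sum_congr rfl fun b _ => ?_
    rw [← mul_assoc, pow_mul]
  have hnd : n / d = 4 * M := by rw [hnM, Nat.mul_div_cancel_left _ hd0]
  rw [Finset.sum_sub_distrib, hS, hS', hnd]
  rcases Nat.even_or_odd M with he | ho
  · have hne : padicValNat 2 (4 * M) ≠ 2 := by
      intro h
      obtain ⟨M', hM', h'⟩ := exists_eq_four_mul_odd h
      rw [show M = M' by omega] at he
      exact Nat.not_even_iff_odd.2 hM' he
    rw [if_neg hne, sum_pow_unitsMod4_eq_zero he hr hz, mul_zero, zero_sub, neg_eq_zero]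
    simp only [← inv_pow]
    refine sum_pow_unitsMod4_eq_zero he hr ?_
    rw [inv_pow, inv_pow, hz]
    norm_num
  · rw [if_pos (padicValNat_two_four_mul_odd ho), sum_inv_pow_unitsMod4 ho hr hz]
    ring

lemma exists_odd_of_mem_symbol {n t m : ℕ} (hm : Odd m) {D : Finset ℕ}
    (hD : ∀ d ∈ D, ∃ M, Odd M ∧ d * M = 2 ^ t * m) {σ : ℕ → ℤ} {k : ℕ}
    (hk : k ∈ symbol n D σ) : ∃ k', Odd k' ∧ k = 2 ^ t * k' := by
  simp only [symbol, Finset.mem_biUnion, Gsetr, Finset.mem_filter] at hk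
  obtain ⟨d, hd, -, ⟨b, rfl⟩, hr, -⟩ := hk
  obtain ⟨M, hM, hdM⟩ := hD d hd
  have hd0 : 0 < d := Nat.pos_of_ne_zero fun h => by
    have := hm.pos
    have h' : 0 < 2 ^ t * m := by positivity
    simp [h] at hdM
    omega
  have hT : 2 ^ t ∣ d :=
    (Nat.Coprime.pow_left t (Nat.coprime_two_left.2 hM)).dvd_of_dvd_mul_right ⟨m, hdM⟩
  obtain ⟨e, rfl⟩ := hT
  rw [mul_assoc] at hdM
  have heM : e * M = m := Nat.eq_of_mul_eq_mul_left (by positivity) hdM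
  rw [Nat.mul_div_cancel_left _ hd0] at hr
  have hb : Odd b := Nat.odd_iff.2 (by split_ifs at hr <;> omega)
  exact ⟨e * b, (Nat.odd_mul.1 (heM ▸ hm)).1.mul hb, mul_assoc _ _ _⟩

lemma add_half_notMem_symbol {n q k k' : ℕ} (hq : 0 < q) (hn : n = 4 * q) {D : Finset ℕ}
    (hD : ∀ d ∈ D, ∃ M, Odd M ∧ d * M = q) {σ : ℕ → ℤ} (hk : k ∈ symbol n D σ)
    (hk' : k' ∈ symbol n D σ) : k' ≠ k + 2 * q := by
  intro h
  simp only [symbol, Finset.mem_biUnion, Gsetr, Finset.mem_filter] at hk hk'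
  obtain ⟨d, hd, -, hdk, hr, hg⟩ := hk
  obtain ⟨e, he, -, hek, hr', hg'⟩ := hk'
  obtain ⟨M, hM, hdM⟩ := hD d hd
  obtain ⟨M', hM', heM⟩ := hD e he
  have hdq : d ∣ q := ⟨M, hdM.symm⟩
  have heq : e ∣ q := ⟨M', heM.symm⟩
  have hde : d ∣ e := by
    rw [← hg', h, hn]
    exact Nat.dvd_gcd (hdk.add (hdq.mul_left _)) (hdq.mul_left _)
  have hed : e ∣ d := by
    rw [← hg]
    refine Nat.dvd_gcd ?_ (hn ▸ heq.mul_left _)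
    rw [h] at hek
    exact (Nat.dvd_add_left (heq.mul_left _)).1 hek
  obtain rfl := Nat.dvd_antisymm hde hed
  obtain ⟨b, rfl⟩ := hdk
  have hd0 : 0 < d := Nat.pos_of_dvd_of_pos hdq hq
  rw [h, ← hdM, show d * b + 2 * (d * M) = d * (b + 2 * M) by ring,
    Nat.mul_div_cancel_left _ hd0] at hr'
  rw [Nat.mul_div_cancel_left _ hd0] at hr
  obtain ⟨K, hK⟩ := hM
  omega

lemma lt_of_mem_symbol {n k : ℕ} {D : Finset ℕ} {σ : ℕ → ℤ} (hk : k ∈ symbol n D σ) :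
    k < n := by
  simp only [symbol, Finset.mem_biUnion, Gsetr, Finset.mem_filter, Finset.mem_range] at hk
  obtain ⟨d, -, h, -⟩ := hk
  exact h

lemma sum_pow_odd_mul (ω : ℂ) (m c : ℕ) :
    ∑ l ∈ Finset.range m, ω ^ ((2 * l + 1) * c) =
      ω ^ c * ∑ l ∈ Finset.range m, (ω ^ (2 * c)) ^ l := by
  rw [Finset.mul_sum]
  refine Finset.sum_congr rfl fun l _ => ?_
  rw [← pow_mul, ← pow_add]
  congr 1
  ring

/-- Fourier inversion over odd indices. -/
lemma sum_fourier {n t m : ℕ} (hm : Odd m) (hn : n = 4 * (2 ^ t * m)) {D : Finset ℕ}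
    (hD : ∀ d ∈ D, ∃ M, Odd M ∧ d * M = 2 ^ t * m) {σ : ℕ → ℤ} {ω : ℂ}
    (hω : IsPrimitiveRoot ω n) {k₀ : ℕ} (hk₀ : k₀ ∈ symbol n D σ) :
    ∑ l ∈ Finset.range m, ω ^ ((2 * l + 1) * (n - k₀)) *
      ∑ k ∈ symbol n D σ, ω ^ ((2 * l + 1) * k) = m := by
  have hlt₀ := lt_of_mem_symbol hk₀
  have hq : 0 < 2 ^ t * m := by have := hm.pos; positivity
  have key : ∀ k ∈ symbol n D σ,
      ∑ l ∈ Finset.range m, ω ^ ((2 * l + 1) * (n - k₀ + k)) = if k = k₀ then (m : ℂ) else 0 := by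
    intro k hk
    have hlt := lt_of_mem_symbol hk
    split_ifs with h
    · rw [h, Nat.sub_add_cancel hlt₀.le]
      simp [mul_comm _ n, pow_mul, hω.pow_eq_one]
    · rw [sum_pow_odd_mul, geom_sum_eq_zero_of_pow_eq_one, mul_zero]
      · intro h1
        rw [hω.pow_eq_one_iff_dvd] at h1
        nth_rewrite 1 [hn] at h1
        obtain ⟨c, hc⟩ := h1
        have hc' : n - k₀ + k = 2 * (2 ^ t * m) * c := by linarith
        have h2 := add_half_notMem_symbol hq hn hD hk₀ hk
        have h3 := add_half_notMem_symbol hq hn hD hk hk₀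
        generalize 2 ^ t * m = q at *
        have hcl : c < 4 := by
          by_contra hge
          have : 2 * q * 4 ≤ 2 * q * c := Nat.mul_le_mul_left _ (by omega)
          omega
        interval_cases c <;> omega
      · obtain ⟨a, ha, rfl⟩ := exists_odd_of_mem_symbol hm hD hk₀
        obtain ⟨b, hb, rfl⟩ := exists_odd_of_mem_symbol hm hD hk
        rw [← pow_mul, hω.pow_eq_one_iff_dvd]
        have hodd : Odd (4 * m - a) := by
          have : a < 4 * m := by
            rw [hn, mul_left_comm] at hlt₀
            exact lt_of_mul_lt_mul_left hlt₀ (by positivity)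
          obtain ⟨a', rfl⟩ := ha
          exact Nat.odd_iff.2 (by omega)
        obtain ⟨e, he⟩ := hodd.add_odd hb
        refine ⟨e, ?_⟩
        rw [hn, show 4 * (2 ^ t * m) - 2 ^ t * a = 2 ^ t * (4 * m - a) by
          rw [Nat.mul_sub]; congr 1; ring, ← mul_add, he]
        ring
  simp only [Finset.mul_sum, ← pow_add, ← mul_add]
  rw [Finset.sum_comm, Finset.sum_congr rfl key, Finset.sum_ite_eq' _ k₀, if_pos hk₀]

/-- If `k₀` is not a multiple of `n/4`, the sign character has no component at `k₀`. -/
lemma sum_sign_eq_zero {n t m : ℕ} (hm : Odd m) (hn : n = 4 * (2 ^ t * m)) {D : Finset ℕ}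
    (hD : ∀ d ∈ D, ∃ M, Odd M ∧ d * M = 2 ^ t * m) {σ : ℕ → ℤ} {ω : ℂ}
    (hω : IsPrimitiveRoot ω n) (hω2 : ω ^ (n / 2) = -1) {k₀ : ℕ} (hk₀ : k₀ ∈ symbol n D σ)
    (hndvd : ¬ 2 ^ t * m ∣ k₀) :
    ∑ l ∈ Finset.range m, ω ^ ((2 * l + 1) * (n - k₀)) * (-1) ^ l = 0 := by
  have hlt₀ := lt_of_mem_symbol hk₀
  have h1 : ∀ l, ω ^ ((2 * l + 1) * (n - k₀)) * (-1) ^ l =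
      ω ^ (n - k₀) * (-ω ^ (2 * (n - k₀))) ^ l := by
    intro l
    rw [neg_pow (ω ^ _), ← pow_mul, mul_left_comm, ← pow_add, mul_comm]
    congr 2
    ring
  simp only [h1]
  rw [← Finset.mul_sum, geom_sum_eq_zero_of_pow_eq_one, mul_zero]
  · intro h
    have h4 : ω ^ (4 * (n - k₀)) = 1 := by
      rw [show 4 * (n - k₀) = 2 * (n - k₀) * 2 by ring, pow_mul, ← neg_sq, h, one_pow]
    rw [hω.pow_eq_one_iff_dvd] at h4
    nth_rewrite 1 [hn] at h4
    have h5 := Nat.dvd_of_mul_dvd_mul_left (by norm_num) h4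
    exact hndvd ((Nat.dvd_sub_iff_right hlt₀.le (hn ▸ dvd_mul_left _ _)).1 h5)
  · obtain ⟨a, ha, rfl⟩ := exists_odd_of_mem_symbol hm hD hk₀
    have hodd : Odd (4 * m - a) := by
      have : a < 4 * m := by
        rw [hn, mul_left_comm] at hlt₀
        exact lt_of_mul_lt_mul_left hlt₀ (by positivity)
      obtain ⟨a', rfl⟩ := ha
      exact Nat.odd_iff.2 (by omega)
    have hh : n / 2 = 2 * (2 ^ t * m) := by omega
    rw [hm.neg_pow, ← pow_mul, show 2 * (n - 2 ^ t * a) * m = n / 2 * (4 * m - a) by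
      rw [hh, hn, show 4 * (2 ^ t * m) - 2 ^ t * a = 2 ^ t * (4 * m - a) by
          rw [Nat.mul_sub]; congr 1; ring]
      ring, pow_mul, hω2, hodd.neg_one_pow, neg_neg]

lemma exists_mem_Gsetr {N d r : ℕ} (hd : 0 < d) (hN : 0 < N) (h4 : 4 ∣ N)
    (hr : r = 1 ∨ r = 3) : ∃ k, k ∈ Gsetr (d * N) r d := by
  suffices ∃ b, b ∈ unitsMod4 N r by
    obtain ⟨b, hb⟩ := this
    exact ⟨d * b, (mem_Gsetr_iff hd).2 ⟨b, hb, rfl⟩⟩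
  simp only [unitsMod4, Finset.mem_filter, Finset.mem_range]
  obtain ⟨M, rfl⟩ := h4
  rcases hr with rfl | rfl
  · exact ⟨1, by omega, rfl, Nat.coprime_one_left _⟩
  · refine ⟨4 * M - 1, by omega, by omega, ?_⟩
    exact coprime_of_dvd_add_of_coprime (a := 1) (by rw [Nat.add_sub_cancel' (by omega)])
      (Nat.coprime_one_left _)

lemma symbol_singleton {n q : ℕ} (hq : 0 < q) (hn : n = 4 * q) (σ : ℕ → ℤ) :
    symbol n {q} σ = {q * (if σ q = 1 then 1 else 3)} := by
  have hr : (if σ q = 1 then 1 else 3) = 1 ∨ (if σ q = 1 then 1 else 3) = 3 := by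
    split_ifs <;> simp
  rw [symbol, Finset.singleton_biUnion]
  generalize (if σ q = 1 then 1 else 3) = r at hr ⊢
  ext k
  rw [hn, mul_comm, mem_Gsetr_iff hq, Finset.mem_singleton]
  constructor
  · rintro ⟨b, hb, rfl⟩
    simp only [unitsMod4, Finset.mem_filter, Finset.mem_range] at hb
    rw [show b = r by omega]
  · rintro rfl
    refine ⟨r, ?_, rfl⟩
    rcases hr with rfl | rfl <;> decide

lemma isIntegral_of_pow_eq_one {ω : ℂ} {n : ℕ} (hn : 0 < n) (h : ω ^ n = 1) :
    IsIntegral ℤ ω :=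
  IsIntegral.of_pow hn (h ▸ isIntegral_one)

theorem parity_iff_D2 (n : ℕ) [NeZero n] (hn4 : 4 ∣ n)
    (D : Finset ℕ) (hD : ∀ d ∈ D, d ∣ n / 4)
    (σ : ℕ → ℤ) (hσ : ∀ d ∈ D, σ d = 1 ∨ σ d = -1)
    (μ : ℕ → ℤ) (hμ : ∀ j < n, (μ j : ℂ) = eigval n (symbol n D σ) j)
    (hD2 : (D.filter (fun d => padicValNat 2 (n / d) = 2)).Nonempty) :
    (∀ j < n, Odd j → (2 : ℤ) ∣ μ j) ∧
    ((∀ j₁ < n, ∀ j₂ < n, Odd j₁ → Odd j₂ → (μ j₁ / 2) % 2 = (μ j₂ / 2) % 2) ↔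
      D.filter (fun d => padicValNat 2 (n / d) = 2) = {n / 4}) := by
  have hn0 : 0 < n := Nat.pos_of_ne_zero (NeZero.ne n)
  obtain ⟨q, hq⟩ := hn4
  have hnq : n / 4 = q := by omega
  have hq0 : 0 < q := by omega
  obtain ⟨t, m, hm, rfl⟩ := Nat.exists_eq_two_pow_mul_odd hq0.ne'
  obtain ⟨ω, hωdef⟩ : ∃ ω, ω = Complex.exp (2 * Real.pi * Complex.I / n) := ⟨_, rfl⟩
  have hω : IsPrimitiveRoot ω n := hωdef ▸ Complex.isPrimitiveRoot_exp n hn0.ne'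
  have hω2 : ω ^ (n / 2) = -1 :=
    (hω.pow hn0 (show n = n / 2 * 2 by omega)).eq_neg_one_of_two_right
  have hωI : IsIntegral ℤ ω := isIntegral_of_pow_eq_one hn0 hω.pow_eq_one
  have hD' : ∀ d ∈ D.filter (fun d => padicValNat 2 (n / d) = 2),
      ∃ M, Odd M ∧ d * M = 2 ^ t * m := by
    intro d hd
    rw [Finset.mem_filter] at hd
    obtain ⟨M, hM, h⟩ := exists_eq_four_mul_odd hd.2
    refine ⟨M, hM, ?_⟩
    have hdn : d ∣ n := (hD d hd.1).trans (Nat.div_dvd_of_dvd ⟨_, hq⟩)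
    have h' := Nat.mul_div_cancel' hdn
    rw [h] at h'
    linarith
  have heig : ∀ j < n, Odd j → (μ j : ℂ) = 2 * (Complex.I *
      ∑ k ∈ symbol n (D.filter (fun d => padicValNat 2 (n / d) = 2)) σ, ω ^ (j * k)) :=
    fun j hj hjo => (hμ j hj).trans
      (eigval_symbol_of_odd hn0 ⟨_, hq⟩ hD σ hωdef hω2 hjo)
  generalize D.filter (fun d => padicValNat 2 (n / d) = 2) = E at *
  have hdvd : ∀ j < n, Odd j → (2 : ℤ) ∣ μ j := fun j hj hjo =>
    two_dvd_of_eq_two_mul_isIntegral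
      (isIntegral_I.mul (IsIntegral.sum _ fun k _ => hωI.pow _)) (heig j hj hjo)
  have hhalf : ∀ j < n, Odd j → ((μ j / 2 : ℤ) : ℂ) =
      Complex.I * ∑ k ∈ symbol n E σ, ω ^ (j * k) := by
    intro j hj hjo
    have h1 : ((2 * (μ j / 2) : ℤ) : ℂ) = μ j := by rw [Int.mul_ediv_cancel' (hdvd j hj hjo)]
    rw [heig j hj hjo] at h1
    push_cast at h1
    exact mul_left_cancel₀ two_ne_zero h1
  refine ⟨hdvd, ?_, ?_⟩
  · intro hpar
    rw [Finset.eq_singleton_iff_nonempty_unique_mem]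
    refine ⟨hD2, fun d hd => ?_⟩
    obtain ⟨M, hM, hdM⟩ := hD' d hd
    have hdq : d ∣ 2 ^ t * m := ⟨M, hdM.symm⟩
    have hd0 : 0 < d := Nat.pos_of_dvd_of_pos hdq hq0
    rw [hnq]
    by_contra hne
    have hr : (if σ d = 1 then 1 else 3) = 1 ∨ (if σ d = 1 then 1 else 3) = 3 := by
      split_ifs <;> simp
    obtain ⟨k₀, hk₀⟩ := exists_mem_Gsetr (N := 4 * M) hd0 (by have := hM.pos; omega)
      (dvd_mul_right _ _) hr
    rw [show d * (4 * M) = n by rw [hq, ← hdM]; ring] at hk₀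
    have hmem : k₀ ∈ symbol n E σ := Finset.mem_biUnion.2 ⟨d, hd, hk₀⟩
    have hndvd : ¬ 2 ^ t * m ∣ k₀ := by
      intro h
      simp only [Gsetr, Finset.mem_filter] at hk₀
      refine hne (Nat.dvd_antisymm hdq ?_)
      rw [← hk₀.2.2.2]
      exact Nat.dvd_gcd h (hq ▸ dvd_mul_left _ _)
    have hlt : ∀ l ∈ Finset.range m, 2 * l + 1 < n := by
      intro l hl
      rw [Finset.mem_range] at hl
      have : 1 * m ≤ 2 ^ t * m := Nat.mul_le_mul_right _ Nat.one_le_two_pow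
      omega
    have h1n : 1 < n := by omega
    have hg : ∀ l ∈ Finset.range m, ∃ g : ℤ,
        μ (2 * l + 1) / 2 = (-1) ^ l * (μ 1 / 2) + 2 * g := by
      intro l hl
      have h := hpar _ (hlt l hl) 1 h1n (odd_two_mul_add_one l) odd_one
      rcases neg_one_pow_eq_or ℤ l with h' | h' <;> rw [h']
      · exact ⟨(μ (2 * l + 1) / 2 - μ 1 / 2) / 2, by omega⟩
      · exact ⟨(μ (2 * l + 1) / 2 + μ 1 / 2) / 2, by omega⟩
    choose! g hg using hg
    have hsum := sum_fourier hm hq hD' hω hmem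
    have hsign := sum_sign_eq_zero hm hq hD' hω hω2 hmem hndvd
    have hIm : Complex.I * m =
        2 * ∑ l ∈ Finset.range m, ω ^ ((2 * l + 1) * (n - k₀)) * (g l : ℂ) := by
      calc Complex.I * m
          = ∑ l ∈ Finset.range m, ω ^ ((2 * l + 1) * (n - k₀)) *
              ((μ (2 * l + 1) / 2 : ℤ) : ℂ) := by
            rw [← hsum, Finset.mul_sum]
            refine Finset.sum_congr rfl fun l hl => ?_
            rw [hhalf _ (hlt l hl) (odd_two_mul_add_one l), mul_left_comm]
        _ = (∑ l ∈ Finset.range m, ω ^ ((2 * l + 1) * (n - k₀)) * (-1) ^ l) *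
              ((μ 1 / 2 : ℤ) : ℂ) +
            2 * ∑ l ∈ Finset.range m, ω ^ ((2 * l + 1) * (n - k₀)) * (g l : ℂ) := by
            rw [Finset.sum_mul, Finset.mul_sum, ← Finset.sum_add_distrib]
            refine Finset.sum_congr rfl fun l hl => ?_
            rw [hg l hl]
            push_cast
            ring
        _ = _ := by rw [hsign, zero_mul, zero_add]
    have hint : IsIntegral ℤ
        (∑ l ∈ Finset.range m, ω ^ ((2 * l + 1) * (n - k₀)) * (g l : ℂ)) :=
      IsIntegral.sum _ fun l _ => (hωI.pow _).mul (isIntegral_algebraMap (x := g l))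
    have h2 : (2 : ℤ) ∣ m := by
      refine two_dvd_of_eq_two_mul_isIntegral ((isIntegral_I.neg).mul hint) ?_
      rw [mul_left_comm, ← hIm, ← mul_assoc, neg_mul, Complex.I_mul_I]
      simp
    exact Nat.not_even_iff_odd.2 hm (even_iff_two_dvd.2 (by exact_mod_cast h2))
  · intro hE
    have hone : ∀ j < n, Odd j → (μ j / 2) % 2 = 1 := by
      intro j hj hjo
      have h := hhalf j hj hjo
      rw [hE, hnq, symbol_singleton hq0 hq, Finset.sum_singleton] at h
      have hrodd : Odd (if σ (2 ^ t * m) = 1 then 1 else 3) := by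
        split_ifs <;> decide
      have hsq : ((μ j / 2 : ℤ) : ℂ) ^ 2 = 1 := by
        rw [h, mul_pow, Complex.I_sq, ← pow_mul,
          show j * (2 ^ t * m * (if σ (2 ^ t * m) = 1 then 1 else 3)) * 2 =
            n / 2 * (j * (if σ (2 ^ t * m) = 1 then 1 else 3)) by
            rw [show n / 2 = 2 * (2 ^ t * m) by omega]; ring,
          pow_mul, hω2, (hjo.mul hrodd).neg_one_pow]
        norm_num
      have hsq' : (μ j / 2) ^ 2 = 1 := by exact_mod_cast hsq
      rcases eq_or_eq_neg_of_sq_eq_sq _ 1 (hsq'.trans (one_pow 2).symm) with h | h <;> omega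
    intro j₁ h₁ j₂ h₂ ho₁ ho₂
    rw [hone j₁ h₁ ho₁, hone j₂ h₂ ho₂]

end
end
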